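/- arXiv:math/0703195 — 6 statements merged into one kernel-verified Lean document; each statement's English description precedes it below -/
import Mathlib

section
/- (Euclidean algorithm via the companion matrix) Let R be a commutative ring, let Z ∈ R[X] be monic of degree m ≥ 1, and let C : Matrix (Fin m) (Fin m) R be the companion matrix of Z, i.e. C i j = 1 if i = j + 1, C i (m−1) = −Z.coeff i for the last column, and C i j = 0 otherwise (precisely: C i j := (if (j : ℕ) + 1 = i then 1 else 0) + (if (j : ℕ) = m − 1 then −Z.coeff i else 0)). Then for every polynomial P ∈ R[X] and every i : Fin m, the (i,0) entry of the matrix P(C) := Polynomial.aeval C P equals (P %ₘ Z).coeff i; i.e. the first column of P(C) is the coefficient vector of the remainder of P on division by Z. -/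
open Polynomial

/-- **Euclidean algorithm via the companion matrix.**
For a monic polynomial `Z` of degree `m ≥ 1` over a commutative ring `R`, with companion
matrix `C`, the first column of `P(C)` is the coefficient vector of `P %ₘ Z`. -/
theorem companion_matrix_euclidean_algorithm
    (R : Type*) [CommRing R] (m : ℕ) (hm : 1 ≤ m)
    (Z : R[X]) (hZmonic : Z.Monic) (hZdeg : Z.natDegree = m)
    (C : Matrix (Fin m) (Fin m) R)
    (hC : ∀ i j : Fin m, C i j =
      (if (j : ℕ) + 1 = (i : ℕ) then 1 else 0) +
      (if (j : ℕ) = m - 1 then -Z.coeff (i : ℕ) else 0)) :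
    ∀ (P : R[X]) (i : Fin m),
      (Polynomial.aeval C P) i ⟨0, hm⟩ = (P %ₘ Z).coeff (i : ℕ) := by
  nontriviality R
  have hdegZ : Z.degree = (m : ℕ) := by
    rw [degree_eq_natDegree hZmonic.ne_zero, hZdeg]
  have step : ∀ Q : R[X], (X * Q) %ₘ Z =
      X * (Q %ₘ Z) - Polynomial.C ((Q %ₘ Z).coeff (m - 1)) * Z := by
    intro Q
    have hr : (Q %ₘ Z).degree < (m : ℕ) := hdegZ ▸ degree_modByMonic_lt Q hZmonic
    have hQ := modByMonic_add_div Q Z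
    refine (div_modByMonic_unique
      (X * (Q /ₘ Z) + Polynomial.C ((Q %ₘ Z).coeff (m - 1))) _ hZmonic ⟨?_, ?_⟩).2
    · linear_combination X * hQ
    · rw [hdegZ, degree_lt_iff_coeff_zero]
      intro k hk
      obtain ⟨k, rfl⟩ : ∃ l, k = l + 1 := ⟨k - 1, by omega⟩
      rw [coeff_sub, coeff_X_mul, coeff_C_mul]
      rcases Nat.eq_or_lt_of_le hk with h | h
      · have h1 : Z.coeff (k + 1) = 1 := by
          rw [← h, ← hZdeg]; exact hZmonic
        have h2 : m - 1 = k := by omega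
        rw [h1, h2]; ring
      · rw [coeff_eq_zero_of_natDegree_lt (p := Z) (by omega),
          (degree_lt_iff_coeff_zero _ _).1 hr k (by omega)]
        ring
  intro P
  induction P using Polynomial.induction_on with
  | C a =>
    intro i
    rw [(modByMonic_eq_self_iff hZmonic).2
      (lt_of_le_of_lt degree_C_le (by rw [hdegZ]; exact_mod_cast hm)),
      aeval_C, Matrix.algebraMap_matrix_apply, coeff_C]
    simp [Fin.ext_iff]
  | add p q hp hq =>
    intro i
    rw [map_add, Matrix.add_apply, hp, hq, add_modByMonic, coeff_add]
  | monomial n a ih =>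
    intro i
    have e : Polynomial.C a * X ^ (n + 1) = X * (Polynomial.C a * X ^ n) := by ring
    rw [e, step, map_mul, aeval_X, Matrix.mul_apply]
    simp only [ih, hC, add_mul, Finset.sum_add_distrib]
    generalize (Polynomial.C a * X ^ n) %ₘ Z = r
    have hlast : ∑ j : Fin m, (if (j : ℕ) = m - 1 then -Z.coeff (i : ℕ) else 0) * r.coeff j
        = -Z.coeff i * r.coeff (m - 1) := by
      rw [Finset.sum_eq_single (⟨m - 1, by omega⟩ : Fin m)]
      · simp
      · intro b _ hb
        rw [if_neg (fun h => hb (Fin.ext h)), zero_mul]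
      · simp
    have hfirst : ∑ j : Fin m, (if (j : ℕ) + 1 = (i : ℕ) then (1 : R) else 0) * r.coeff j
        = (X * r).coeff i := by
      obtain ⟨i, hi⟩ := i
      cases i with
      | zero => simp
      | succ k =>
        rw [coeff_X_mul, Finset.sum_eq_single (⟨k, by omega⟩ : Fin m)]
        · simp
        · intro b _ hb
          rw [if_neg (fun h => hb (Fin.ext (by simpa using h))), zero_mul]
        · simp
    rw [hlast, hfirst, coeff_sub, coeff_C_mul]
    ring
end

section
/- (Powers of the trivial solution are solutions) With the setup in the context, assume the multiplication condition holds: for every x ∈ U and every a : Fin n the polynomial ∑_{i=0}^{k} ∑_{r=0}^{m−1} (∑_{b} (A_i x) a b · ∂_b Z_r (x)) · X^{i+r} ∈ ℝ[X] is divisible by Z_x. Then for every natural number r, the tuple P^{(r)} defined by P^{(r)}_j(x) := (X^r %ₘ Z_x).coeff j (for j = 0, …, m−1) is a solution of the system; in particular each P^{(r)}_j is differentiable on U. -/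
open Polynomial


lemma op_rewrite {n m k : ℕ} (B : Fin (k + 1) → Fin n → ℝ) (w : Fin m → Fin n → ℝ) :
    (∑ i : Fin (k + 1), ∑ j : Fin m,
      Polynomial.C (∑ b : Fin n, B i b * w j b) * (X : ℝ[X]) ^ ((i : ℕ) + (j : ℕ))) =
    ∑ i : Fin (k + 1), ∑ b : Fin n, Polynomial.C (B i b) * X ^ (i : ℕ) *
      ∑ j : Fin m, Polynomial.C (w j b) * X ^ (j : ℕ) := by
  refine Finset.sum_congr rfl fun i _ => ?_
  simp_rw [map_sum, Finset.sum_mul, Finset.mul_sum]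
  rw [Finset.sum_comm]
  refine Finset.sum_congr rfl fun b _ => Finset.sum_congr rfl fun j _ => ?_
  rw [map_mul, pow_add]
  ring

lemma zpoly_monic {m : ℕ} (z : Fin m → ℝ) :
    (X ^ m + ∑ r : Fin m, Polynomial.C (z r) * X ^ (r : ℕ) : ℝ[X]).Monic ∧
    (X ^ m + ∑ r : Fin m, Polynomial.C (z r) * X ^ (r : ℕ) : ℝ[X]).degree = m := by
  have h : (∑ r : Fin m, Polynomial.C (z r) * X ^ (r : ℕ) : ℝ[X]).degree < (m : ℕ) :=
    Polynomial.degree_sum_fin_lt z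
  refine ⟨Polynomial.monic_X_pow_add h, ?_⟩
  rw [Polynomial.degree_add_eq_left_of_degree_lt (by rwa [Polynomial.degree_X_pow]),
    Polynomial.degree_X_pow]

lemma zpoly_coeff {m : ℕ} (z : Fin m → ℝ) (j : Fin m) :
    (X ^ m + ∑ r : Fin m, Polynomial.C (z r) * X ^ (r : ℕ) : ℝ[X]).coeff j = z j := by
  rw [Polynomial.coeff_add, Polynomial.coeff_X_pow, Polynomial.finset_sum_coeff,
    if_neg (ne_of_lt j.2), zero_add, Finset.sum_eq_single j]
  · simp
  · intro b _ hb
    rw [Polynomial.coeff_C_mul_X_pow, if_neg]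
    exact fun h => hb (Fin.ext h.symm)
  · simp

lemma pow_succ_mod {m : ℕ} (p : ℝ[X]) (hp : p.Monic) (hd : p.degree = ((m + 1 : ℕ) : WithBot ℕ))
    (r : ℕ) :
    X ^ (r + 1) %ₘ p = X * (X ^ r %ₘ p) - Polynomial.C ((X ^ r %ₘ p).coeff m) * p := by
  have hlt : (X ^ r %ₘ p).degree < ((m + 1 : ℕ) : WithBot ℕ) := hd ▸ Polynomial.degree_modByMonic_lt _ hp
  have hpn : p.natDegree = m + 1 := Polynomial.natDegree_eq_of_degree_eq_some hd
  refine (Polynomial.div_modByMonic_unique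
    (X * (X ^ r /ₘ p) + Polynomial.C ((X ^ r %ₘ p).coeff m)) _ hp ⟨?_, ?_⟩).2
  · have h := Polynomial.modByMonic_add_div (X ^ r : ℝ[X]) p
    rw [pow_succ]
    linear_combination X * h
  · rw [hd, Polynomial.degree_lt_iff_coeff_zero]
    intro N hN
    obtain ⟨N, rfl⟩ : ∃ M, N = M + 1 := ⟨N - 1, by omega⟩
    rw [Polynomial.coeff_sub, Polynomial.coeff_X_mul, Polynomial.coeff_C_mul]
    rcases eq_or_lt_of_le hN with h | h
    · have : N = m := by omega
      subst this
      have : p.coeff (N + 1) = 1 := by rw [← hpn]; exact hp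
      rw [this]; ring
    · rw [Polynomial.coeff_eq_zero_of_natDegree_lt (p := p) (by omega),
        (Polynomial.degree_lt_iff_coeff_zero _ _).1 hlt N (by omega)]
      ring

lemma deriv_rec {m : ℕ} (d d' z z' : Fin (m + 1) → ℝ) (c : ℝ)
    (h0 : d' 0 = - (d (Fin.last m) * z 0 + c * z' 0))
    (hs : ∀ j : Fin m, d' j.succ = d j.castSucc - (d (Fin.last m) * z j.succ + c * z' j.succ)) :
    (∑ j : Fin (m + 1), Polynomial.C (d' j) * (X : ℝ[X]) ^ (j : ℕ)) =
      X * (∑ j : Fin (m + 1), Polynomial.C (d j) * X ^ (j : ℕ))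
      - Polynomial.C (d (Fin.last m)) * (X ^ (m + 1) +
          ∑ j : Fin (m + 1), Polynomial.C (z j) * X ^ (j : ℕ))
      - Polynomial.C c * (∑ j : Fin (m + 1), Polynomial.C (z' j) * X ^ (j : ℕ)) := by
  rw [Fin.sum_univ_castSucc (fun j : Fin (m + 1) => Polynomial.C (d j) * (X : ℝ[X]) ^ (j : ℕ)),
    Fin.sum_univ_succ, Fin.sum_univ_succ, Fin.sum_univ_succ, h0]
  simp_rw [hs]
  have : ∀ j : Fin m, Polynomial.C (d j.castSucc - (d (Fin.last m) * z j.succ + c * z' j.succ)) *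
      (X : ℝ[X]) ^ (j.succ : ℕ) = X * (Polynomial.C (d j.castSucc) * X ^ (j.castSucc : ℕ))
      - Polynomial.C (d (Fin.last m)) * (Polynomial.C (z j.succ) * X ^ (j.succ : ℕ))
      - Polynomial.C c * (Polynomial.C (z' j.succ) * X ^ (j.succ : ℕ)) := by
    intro j
    simp only [map_sub, map_add, map_mul, Fin.val_succ, Fin.val_castSucc]
    ring
  rw [Finset.sum_congr rfl fun j _ => this j, Finset.sum_sub_distrib, Finset.sum_sub_distrib,
    ← Finset.mul_sum, ← Finset.mul_sum, ← Finset.mul_sum]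
  simp only [map_neg, map_add, map_mul, Fin.val_zero, Fin.val_last]
  ring

/-- **Powers of the trivial solution are solutions.**
If the multiplication condition `A_μ dZ_μ ≡ 0 (mod Z_μ)` holds on `U`, then for every
`r : ℕ` the tuple of coefficients of `X^r %ₘ Z_x` (the `r`‑th `*`-power `μ^r_*`) is a
solution of the system; in particular each coefficient function is differentiable on `U`. -/
theorem star_powers_are_solutions
    (n m k : ℕ) (hn : 1 ≤ n) (hm : 1 ≤ m)
    (U : Set (Fin n → ℝ)) (hU : IsOpen U)
    (Z : Fin m → (Fin n → ℝ) → ℝ)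
    (hZ : ∀ r : Fin m, ∀ x ∈ U, DifferentiableAt ℝ (Z r) x)
    (A : Fin (k + 1) → (Fin n → ℝ) → Matrix (Fin n) (Fin n) ℝ)
    -- the monic polynomial `Z_x = X^m + ∑_{r<m} Z_r(x) X^r`
    (Zpoly : (Fin n → ℝ) → ℝ[X])
    (hZpoly : ∀ x, Zpoly x = X ^ m + ∑ r : Fin m, Polynomial.C (Z r x) * X ^ (r : ℕ))
    -- the multiplication condition
    (hmult : ∀ x ∈ U, ∀ a : Fin n,
      Zpoly x ∣ ∑ i : Fin (k + 1), ∑ r : Fin m,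
        Polynomial.C (∑ b : Fin n, A i x a b * fderiv ℝ (Z r) x (Pi.single b 1)) *
          X ^ ((i : ℕ) + (r : ℕ))) :
    ∀ r : ℕ,
      (∀ j : Fin m, ∀ x ∈ U,
        DifferentiableAt ℝ (fun y => ((X ^ r %ₘ Zpoly y).coeff (j : ℕ))) x) ∧
      ∀ x ∈ U, ∀ a : Fin n,
        Zpoly x ∣ ∑ i : Fin (k + 1), ∑ j : Fin m,
          Polynomial.C (∑ b : Fin n,
              A i x a b *
                fderiv ℝ (fun y => ((X ^ r %ₘ Zpoly y).coeff (j : ℕ))) x (Pi.single b 1)) *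
            X ^ ((i : ℕ) + (j : ℕ)) := by
  obtain ⟨m, rfl⟩ : ∃ M, m = M + 1 := ⟨m - 1, by omega⟩
  have hmon : ∀ y, (Zpoly y).Monic := fun y => hZpoly y ▸ (zpoly_monic fun r => Z r y).1
  have hdeg : ∀ y, (Zpoly y).degree = ((m + 1 : ℕ) : WithBot ℕ) :=
    fun y => hZpoly y ▸ (zpoly_monic fun r => Z r y).2
  have hcoef : ∀ y (j : Fin (m + 1)), (Zpoly y).coeff j = Z j y :=
    fun y j => hZpoly y ▸ zpoly_coeff (fun r => Z r y) j
  intro r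
  induction r with
  | zero =>
    have h1 : ∀ y, (X ^ 0 : ℝ[X]) %ₘ Zpoly y = 1 := by
      intro y
      rw [pow_zero, Polynomial.modByMonic_eq_self_iff (hmon y), hdeg, Polynomial.degree_one]
      exact_mod_cast Nat.succ_pos m
    simp_rw [h1]
    refine ⟨fun j x _ => differentiableAt_const _, fun x _ a => ?_⟩
    simp
  | succ r ih =>
    obtain ⟨ihd, ihs⟩ := ih
    have h0 : (fun y => (X ^ (r + 1) %ₘ Zpoly y).coeff ((0 : Fin (m + 1)) : ℕ)) =
        fun y => - ((X ^ r %ₘ Zpoly y).coeff (Fin.last m : ℕ) * Z 0 y) := by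
      funext y
      rw [pow_succ_mod _ (hmon y) (hdeg y), Polynomial.coeff_sub, Polynomial.coeff_C_mul, hcoef]
      simp
    have hs : ∀ j : Fin m, (fun y => (X ^ (r + 1) %ₘ Zpoly y).coeff (j.succ : ℕ)) =
        fun y => (X ^ r %ₘ Zpoly y).coeff (j.castSucc : ℕ) -
          (X ^ r %ₘ Zpoly y).coeff (Fin.last m : ℕ) * Z j.succ y := by
      intro j
      funext y
      rw [pow_succ_mod _ (hmon y) (hdeg y), Polynomial.coeff_sub, Polynomial.coeff_C_mul, hcoef,
        Fin.val_succ, Polynomial.coeff_X_mul]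
      simp
    have hmul : ∀ x ∈ U, ∀ j : Fin (m + 1), DifferentiableAt ℝ
        (fun y => (X ^ r %ₘ Zpoly y).coeff (Fin.last m : ℕ) * Z j y) x :=
      fun x hx j => (ihd (Fin.last m) x hx).fun_mul (hZ j x hx)
    have hfd : ∀ x ∈ U, ∀ j : Fin (m + 1), ∀ v, fderiv ℝ
        (fun y => (X ^ r %ₘ Zpoly y).coeff (Fin.last m : ℕ) * Z j y) x v =
        fderiv ℝ (fun y => (X ^ r %ₘ Zpoly y).coeff (Fin.last m : ℕ)) x v * Z j x +
        (X ^ r %ₘ Zpoly x).coeff (Fin.last m : ℕ) * fderiv ℝ (Z j) x v := by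
      intro x hx j v
      rw [fderiv_fun_mul (ihd (Fin.last m) x hx) (hZ j x hx)]
      simp only [ContinuousLinearMap.add_apply, ContinuousLinearMap.smul_apply, smul_eq_mul]
      ring
    refine ⟨fun j x hx => ?_, fun x hx a => ?_⟩
    · refine Fin.cases ?_ (fun j => ?_) j
      · rw [h0]; exact (hmul x hx 0).fun_neg
      · rw [hs]; exact (ihd j.castSucc x hx).fun_sub (hmul x hx j.succ)
    · have hrec := fun b : Fin n => deriv_rec
        (fun j : Fin (m + 1) =>
          fderiv ℝ (fun y => (X ^ r %ₘ Zpoly y).coeff (j : ℕ)) x (Pi.single b 1))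
        (fun j : Fin (m + 1) =>
          fderiv ℝ (fun y => (X ^ (r + 1) %ₘ Zpoly y).coeff (j : ℕ)) x (Pi.single b 1))
        (fun j => Z j x) (fun j => fderiv ℝ (Z j) x (Pi.single b 1))
        ((X ^ r %ₘ Zpoly x).coeff (Fin.last m : ℕ))
        (by
          beta_reduce
          rw [h0, fderiv_fun_neg, ContinuousLinearMap.neg_apply, hfd x hx])
        (by
          intro j
          beta_reduce
          rw [hs, fderiv_fun_sub (ihd j.castSucc x hx) (hmul x hx j.succ),
            ContinuousLinearMap.sub_apply, hfd x hx])
      have e1 := hmult x hx a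
      have e2 := ihs x hx a
      rw [op_rewrite (fun i b => A i x a b) (fun j b => fderiv ℝ (Z j) x (Pi.single b 1))] at e1
      rw [op_rewrite (fun i b => A i x a b) (fun (j : Fin (m + 1)) b =>
        fderiv ℝ (fun y => (X ^ r %ₘ Zpoly y).coeff (j : ℕ)) x (Pi.single b 1))] at e2
      rw [op_rewrite (fun i b => A i x a b) (fun (j : Fin (m + 1)) b =>
        fderiv ℝ (fun y => (X ^ (r + 1) %ₘ Zpoly y).coeff (j : ℕ)) x (Pi.single b 1))]
      rw [Finset.sum_congr rfl fun i _ => Finset.sum_congr rfl fun b _ => by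
        rw [hrec b, ← hZpoly x]]
      have e3 : Zpoly x ∣ ∑ i : Fin (k + 1), ∑ b : Fin n, Polynomial.C (A i x a b) * X ^ (i : ℕ) *
          (Polynomial.C (fderiv ℝ (fun y => (X ^ r %ₘ Zpoly y).coeff (Fin.last m : ℕ)) x
            (Pi.single b 1)) * Zpoly x) :=
        Finset.dvd_sum fun i _ => Finset.dvd_sum fun b _ =>
          Dvd.dvd.mul_left (Dvd.intro_left _ rfl) _
      have := ((e2.mul_left X).sub e3).sub
        (e1.mul_left (Polynomial.C ((X ^ r %ₘ Zpoly x).coeff (Fin.last m : ℕ))))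
      convert this using 1
      rw [Finset.mul_sum, Finset.mul_sum, ← Finset.sum_sub_distrib, ← Finset.sum_sub_distrib]
      refine Finset.sum_congr rfl fun i _ => ?_
      rw [Finset.mul_sum, Finset.mul_sum, ← Finset.sum_sub_distrib, ← Finset.sum_sub_distrib]
      refine Finset.sum_congr rfl fun b _ => ?_
      ring
end

section
/- (General solution of the generic (2,2,1) system) Let I, J ⊆ ℝ be open intervals with I ∩ J = ∅, and let Ω := I × J ⊆ ℝ². Suppose V₀, V₁ : Ω → ℝ are differentiable and satisfy, at every point (x,y) ∈ Ω, the system ∂V₀/∂x = y·∂V₁/∂x and ∂V₀/∂y = x·∂V₁/∂y. Then there exist differentiable functions φ : J → ℝ and ψ : I → ℝ such that for every (x,y) ∈ Ω, V₀(x,y) = (x·φ(y) − y·ψ(x))/(x − y) and V₁(x,y) = (φ(y) − ψ(x))/(x − y). -/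
/-- **General solution of the generic (2,2,1) system.**
If `V₀, V₁` are differentiable on `Ω = I × J` (with `I, J` disjoint open intervals of `ℝ`)
and satisfy `∂V₀/∂x = y ∂V₁/∂x` and `∂V₀/∂y = x ∂V₁/∂y` there, then there exist
differentiable `φ : J → ℝ` and `ψ : I → ℝ` with
`V₀(x,y) = (xφ(y) - yψ(x))/(x-y)` and `V₁(x,y) = (φ(y) - ψ(x))/(x-y)` on `Ω`. -/
theorem generic_221_general_solution (I J : Set ℝ)
    (hIopen : IsOpen I) (hJopen : IsOpen J)
    (hIconv : Convex ℝ I) (hJconv : Convex ℝ J)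
    (hdisj : I ∩ J = ∅)
    (V₀ V₁ : ℝ × ℝ → ℝ)
    (hV₀ : ∀ p ∈ I ×ˢ J, DifferentiableAt ℝ V₀ p)
    (hV₁ : ∀ p ∈ I ×ˢ J, DifferentiableAt ℝ V₁ p)
    (heq₁ : ∀ p ∈ I ×ˢ J, fderiv ℝ V₀ p (1, 0) = p.2 * fderiv ℝ V₁ p (1, 0))
    (heq₂ : ∀ p ∈ I ×ˢ J, fderiv ℝ V₀ p (0, 1) = p.1 * fderiv ℝ V₁ p (0, 1)) :
    ∃ φ ψ : ℝ → ℝ,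
      (∀ y ∈ J, DifferentiableAt ℝ φ y) ∧ (∀ x ∈ I, DifferentiableAt ℝ ψ x) ∧
      ∀ p ∈ I ×ˢ J,
        V₀ p = (p.1 * φ p.2 - p.2 * ψ p.1) / (p.1 - p.2) ∧
        V₁ p = (φ p.2 - ψ p.1) / (p.1 - p.2) := by
  have hx : ∀ x ∈ I, ∀ y ∈ J, ∀ V : ℝ × ℝ → ℝ, DifferentiableAt ℝ V (x, y) →
      HasDerivAt (fun t => V (t, y)) (fderiv ℝ V (x, y) (1, 0)) x := by
    intro x _ y _ V hV
    exact hV.hasFDerivAt.comp_hasDerivAt x ((hasDerivAt_id x).prodMk (hasDerivAt_const x y))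
  have hy : ∀ x ∈ I, ∀ y ∈ J, ∀ V : ℝ × ℝ → ℝ, DifferentiableAt ℝ V (x, y) →
      HasDerivAt (fun t => V (x, t)) (fderiv ℝ V (x, y) (0, 1)) y := by
    intro x _ y _ V hV
    exact hV.hasFDerivAt.comp_hasDerivAt y ((hasDerivAt_const y x).prodMk (hasDerivAt_id y))
  rcases I.eq_empty_or_nonempty with hI | ⟨a, ha⟩
  · subst hI
    exact ⟨0, 0, fun _ _ => differentiableAt_const 0, fun _ _ => differentiableAt_const 0,
      fun p hp => absurd hp.1 (Set.notMem_empty _)⟩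
  rcases J.eq_empty_or_nonempty with hJ | ⟨b, hb⟩
  · subst hJ
    exact ⟨0, 0, fun _ _ => differentiableAt_const 0, fun _ _ => differentiableAt_const 0,
      fun p hp => absurd hp.2 (Set.notMem_empty _)⟩
  have hφ : ∀ x ∈ I, ∀ y ∈ J, V₀ (x, y) - y * V₁ (x, y) = V₀ (a, y) - y * V₁ (a, y) := by
    intro x hxI y hyJ
    have hd : ∀ t ∈ I, HasDerivAt (fun t => V₀ (t, y) - y * V₁ (t, y)) 0 t := by
      intro t ht
      have h := (hx t ht y hyJ V₀ (hV₀ _ ⟨ht, hyJ⟩)).sub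
        ((hx t ht y hyJ V₁ (hV₁ _ ⟨ht, hyJ⟩)).const_mul y)
      rw [heq₁ (t, y) ⟨ht, hyJ⟩, sub_self] at h
      exact h
    exact hIopen.is_const_of_deriv_eq_zero hIconv.isPreconnected
      (fun t ht => (hd t ht).differentiableAt.differentiableWithinAt)
      (fun t ht => (hd t ht).deriv) hxI ha
  have hψ : ∀ x ∈ I, ∀ y ∈ J, V₀ (x, y) - x * V₁ (x, y) = V₀ (x, b) - x * V₁ (x, b) := by
    intro x hxI y hyJ
    have hd : ∀ t ∈ J, HasDerivAt (fun t => V₀ (x, t) - x * V₁ (x, t)) 0 t := by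
      intro t ht
      have h := (hy x hxI t ht V₀ (hV₀ _ ⟨hxI, ht⟩)).sub
        ((hy x hxI t ht V₁ (hV₁ _ ⟨hxI, ht⟩)).const_mul x)
      rw [heq₂ (x, t) ⟨hxI, ht⟩, sub_self] at h
      exact h
    exact hJopen.is_const_of_deriv_eq_zero hJconv.isPreconnected
      (fun t ht => (hd t ht).differentiableAt.differentiableWithinAt)
      (fun t ht => (hd t ht).deriv) hyJ hb
  refine ⟨fun y => V₀ (a, y) - y * V₁ (a, y), fun x => V₀ (x, b) - x * V₁ (x, b), ?_, ?_, ?_⟩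
  · intro y hyJ
    exact (hy a ha y hyJ V₀ (hV₀ _ ⟨ha, hyJ⟩)).differentiableAt.sub
      (differentiableAt_id.mul (hy a ha y hyJ V₁ (hV₁ _ ⟨ha, hyJ⟩)).differentiableAt)
  · intro x hxI
    exact (hx x hxI b hb V₀ (hV₀ _ ⟨hxI, hb⟩)).differentiableAt.sub
      (differentiableAt_id.mul (hx x hxI b hb V₁ (hV₁ _ ⟨hxI, hb⟩)).differentiableAt)
  · rintro ⟨x, y⟩ ⟨hxI, hyJ⟩
    have hne : x - y ≠ 0 := by
      intro h
      have hxy : x = y := sub_eq_zero.mp h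
      subst hxy
      exact Set.notMem_empty x (hdisj ▸ ⟨hxI, hyJ⟩)
    simp only at hxI hyJ ⊢
    rw [← hφ x hxI y hyJ, ← hψ x hxI y hyJ, eq_div_iff hne, eq_div_iff hne]
    constructor <;> ring
end

section
/- (Direct sum of systems with multiplication) Let U ⊆ (Fin n → ℝ) and Ũ ⊆ (Fin n' → ℝ) be open. Let Z_0, …, Z_{m−1} : U → ℝ and Z̃_0, …, Z̃_{m̃−1} : Ũ → ℝ be differentiable, and set Z_x := X^m + ∑_{r<m} Z_r(x)·X^r and Z̃_y := X^{m̃} + ∑_{r<m̃} Z̃_r(y)·X^r. Let A_0, …, A_k : U → Matrix (Fin n) (Fin n) ℝ and Ã_0, …, Ã_{k̃} : Ũ → Matrix (Fin n') (Fin n') ℝ, and assume both systems satisfy the multiplication condition: for every x ∈ U, a : Fin n, the polynomial ∑_{i≤k} ∑_{r<m} (∑_b (A_i x) a b · ∂_b Z_r(x))·X^{i+r} is divisible by Z_x; and for every y ∈ Ũ, a : Fin n', the polynomial ∑_{i≤k̃} ∑_{r<m̃} (∑_b (Ã_i y) a b · ∂_b Z̃_r(y))·X^{i+r} is divisible by Z̃_y.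 Regard functions on U × Ũ as functions of a variable indexed by Fin n ⊕ Fin n', define B_i(x,y) := Matrix.fromBlocks (A_i x) 0 0 (Ã_i y) (with A_i := 0 for i > k and Ã_i := 0 for i > k̃), and let c_r(x,y) := (Z_x · Z̃_y).coeff r for r < m + m̃. Then the combined system satisfies the multiplication condition: for every (x,y) ∈ U × Ũ and every a : Fin n ⊕ Fin n', the polynomial ∑_{i ≤ max(k,k̃)} ∑_{r < m+m̃} (∑_b (B_i(x,y)) a b · ∂_b c_r(x,y))·X^{i+r} is divisible by Z_x · Z̃_y. -/
open Polynomial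

lemma dsm_coeff {E : Type*} [NormedAddCommGroup E] [NormedSpace ℝ E] (m : ℕ)
    (W : Fin m → E → ℝ) (p : E) (hW : ∀ s, DifferentiableAt ℝ (W s) p) (j : ℕ) :
    HasFDerivAt (fun q => (X ^ m + ∑ s : Fin m, C (W s q) * X ^ (s : ℕ) : ℝ[X]).coeff j)
      (∑ s : Fin m, ((X ^ (s : ℕ) : ℝ[X]).coeff j) • fderiv ℝ (W s) p) p := by
  simp only [coeff_add, finsetSum_coeff, coeff_C_mul]
  refine HasFDerivAt.const_add _ ?_
  exact HasFDerivAt.fun_sum fun s _ => (hW s).hasFDerivAt.mul_const _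

lemma dsm_key {E : Type*} [NormedAddCommGroup E] [NormedSpace ℝ E] (m m' : ℕ)
    (W : Fin m → E → ℝ) (W' : Fin m' → E → ℝ) (p : E)
    (hW : ∀ s, DifferentiableAt ℝ (W s) p) (hW' : ∀ s, DifferentiableAt ℝ (W' s) p)
    (v : E) (r : ℕ) :
    fderiv ℝ (fun q => ((X ^ m + ∑ s : Fin m, C (W s q) * X ^ (s : ℕ)) *
      (X ^ m' + ∑ s : Fin m', C (W' s q) * X ^ (s : ℕ)) : ℝ[X]).coeff r) p v =
    ((∑ s : Fin m, C (fderiv ℝ (W s) p v) * X ^ (s : ℕ)) *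
      (X ^ m' + ∑ s : Fin m', C (W' s p) * X ^ (s : ℕ)) +
     (X ^ m + ∑ s : Fin m, C (W s p) * X ^ (s : ℕ)) *
      (∑ s : Fin m', C (fderiv ℝ (W' s) p v) * X ^ (s : ℕ)) : ℝ[X]).coeff r := by
  have h1 := dsm_coeff m W p hW
  have h2 := dsm_coeff m' W' p hW'
  have h := HasFDerivAt.fun_sum (u := Finset.HasAntidiagonal.antidiagonal r)
    (fun x _ => (h1 x.1).mul (h2 x.2))
  have e : (fun q => ((X ^ m + ∑ s : Fin m, C (W s q) * X ^ (s : ℕ)) *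
      (X ^ m' + ∑ s : Fin m', C (W' s q) * X ^ (s : ℕ)) : ℝ[X]).coeff r) = _ :=
    funext fun q => coeff_mul _ _ r
  rw [e]
  refine (congrArg (fun L => L v) h.fderiv).trans ?_
  rw [coeff_add, coeff_mul, coeff_mul, ← Finset.sum_add_distrib, ContinuousLinearMap.sum_apply]
  refine Finset.sum_congr rfl fun x _ => ?_
  have c1 : ∀ (N : ℕ) (V : Fin N → E → ℝ) (j : ℕ),
      (∑ s : Fin N, ((X ^ (s : ℕ) : ℝ[X]).coeff j) • fderiv ℝ (V s) p) v =
      (∑ s : Fin N, C (fderiv ℝ (V s) p v) * X ^ (s : ℕ) : ℝ[X]).coeff j := by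
    intro N V j
    rw [ContinuousLinearMap.sum_apply, finsetSum_coeff]
    refine Finset.sum_congr rfl fun s _ => ?_
    rw [coeff_C_mul, ContinuousLinearMap.smul_apply, smul_eq_mul, mul_comm]
  rw [ContinuousLinearMap.add_apply, ContinuousLinearMap.smul_apply,
    ContinuousLinearMap.smul_apply, c1, c1, smul_eq_mul, smul_eq_mul]
  ring

lemma dsm_deg (m : ℕ) (c : Fin m → ℝ) :
    (∑ s : Fin m, C (c s) * X ^ (s : ℕ) : ℝ[X]).degree < m := by
  refine (Polynomial.degree_sum_le _ _).trans_lt ?_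
  refine (Finset.sup_lt_iff (WithBot.bot_lt_coe m)).2 ?_
  intro s _
  exact (degree_C_mul_X_pow_le _ _).trans_lt (WithBot.coe_lt_coe.2 s.2)

lemma dsm_deg' (m : ℕ) (c : Fin m → ℝ) :
    (X ^ m + ∑ s : Fin m, C (c s) * X ^ (s : ℕ) : ℝ[X]).degree = m := by
  rw [degree_add_eq_left_of_degree_lt] <;> rw [degree_X_pow]
  exact dsm_deg m c

lemma dsm_sum {E : Type*} [NormedAddCommGroup E] [NormedSpace ℝ E] (m m' : ℕ)
    (W : Fin m → E → ℝ) (W' : Fin m' → E → ℝ) (p : E)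
    (hW : ∀ s, DifferentiableAt ℝ (W s) p) (hW' : ∀ s, DifferentiableAt ℝ (W' s) p)
    (v : E) (i : ℕ) :
    ∑ r ∈ Finset.range (m + m'), C (fderiv ℝ (fun q =>
      ((X ^ m + ∑ s : Fin m, C (W s q) * X ^ (s : ℕ)) *
      (X ^ m' + ∑ s : Fin m', C (W' s q) * X ^ (s : ℕ)) : ℝ[X]).coeff r) p v) * X ^ (i + r) =
    (∑ s : Fin m, C (fderiv ℝ (W s) p v) * X ^ (i + (s : ℕ))) *
      (X ^ m' + ∑ s : Fin m', C (W' s p) * X ^ (s : ℕ)) +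
     (X ^ m + ∑ s : Fin m, C (W s p) * X ^ (s : ℕ)) *
      (∑ s : Fin m', C (fderiv ℝ (W' s) p v) * X ^ (i + (s : ℕ)) : ℝ[X]) := by
  have hX : ∀ (N : ℕ) (c : Fin N → ℝ), (∑ s : Fin N, C (c s) * X ^ (i + (s : ℕ)) : ℝ[X]) =
      X ^ i * ∑ s : Fin N, C (c s) * X ^ (s : ℕ) := by
    intro N c
    rw [Finset.mul_sum]
    exact Finset.sum_congr rfl fun s _ => by ring
  rw [hX, hX]
  simp_rw [dsm_key m m' W W' p hW hW' v]
  set P := ((∑ s : Fin m, C (fderiv ℝ (W s) p v) * X ^ (s : ℕ)) *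
      (X ^ m' + ∑ s : Fin m', C (W' s p) * X ^ (s : ℕ)) +
     (X ^ m + ∑ s : Fin m, C (W s p) * X ^ (s : ℕ)) *
      (∑ s : Fin m', C (fderiv ℝ (W' s) p v) * X ^ (s : ℕ)) : ℝ[X]) with hP
  have hdeg : P.degree < ((m + m' : ℕ) : WithBot ℕ) := by
    rw [hP]
    refine (degree_add_le _ _).trans_lt (max_lt ?_ ?_)
    · rw [degree_mul, dsm_deg', Nat.cast_add]
      exact WithBot.add_lt_add_right (WithBot.coe_ne_bot) (dsm_deg m _)
    · rw [degree_mul, dsm_deg', Nat.cast_add]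
      exact WithBot.add_lt_add_left (WithBot.coe_ne_bot) (dsm_deg m' _)
  have hs : P = ∑ r ∈ Finset.range (m + m'), C (P.coeff r) * X ^ r := by
    ext j
    simp only [finsetSum_coeff, coeff_C_mul_X_pow]
    rw [Finset.sum_ite_eq]
    split_ifs with h
    · rfl
    · exact coeff_eq_zero_of_degree_lt (hdeg.trans_le (by
        exact_mod_cast not_lt.1 (fun h' => h (Finset.mem_range.2 h'))))
  calc _ = X ^ i * ∑ r ∈ Finset.range (m + m'), C (P.coeff r) * X ^ r := by
        rw [Finset.mul_sum]
        exact Finset.sum_congr rfl fun s _ => by ring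
    _ = X ^ i * P := by rw [← hs]
    _ = _ := by rw [hP]; ring

/-- Extending the range of summation. -/
lemma dsm_range (k K : ℕ) (h : k ≤ K) (f : ℕ → ℝ[X]) (hf : ∀ i, k < i → f i = 0) :
    ∑ i ∈ Finset.range (K + 1), f i = ∑ i ∈ Finset.range (k + 1), f i := by
  symm
  refine Finset.sum_subset (fun i hi => ?_) fun i _ hi => hf i ?_
  · simp only [Finset.mem_range] at *; omega
  · simp only [Finset.mem_range] at *; omega

lemma dsm_fderiv_comp {ι κ : Type*} [Fintype ι] [Fintype κ] (g : ι → κ) (f : (ι → ℝ) → ℝ)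
    (p v : κ → ℝ) (hf : DifferentiableAt ℝ f (p ∘ g)) :
    DifferentiableAt ℝ (fun q : κ → ℝ => f (q ∘ g)) p ∧
    fderiv ℝ (fun q : κ → ℝ => f (q ∘ g)) p v = fderiv ℝ f (p ∘ g) (v ∘ g) := by
  let L : (κ → ℝ) →L[ℝ] (ι → ℝ) := ContinuousLinearMap.pi fun i => ContinuousLinearMap.proj (g i)
  have h : HasFDerivAt (fun q : κ → ℝ => f (q ∘ g)) ((fderiv ℝ f (p ∘ g)).comp L) p :=
    HasFDerivAt.comp (f := fun q : κ → ℝ => q ∘ g) p hf.hasFDerivAt L.hasFDerivAt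
  exact ⟨h.differentiableAt, by rw [h.fderiv]; rfl⟩

lemma dsm_lin {ι : Type*} [Fintype ι] [DecidableEq ι] (L : (ι → ℝ) →L[ℝ] ℝ) (c : ι → ℝ) :
    ∑ b, c b * L (Pi.single b 1) = L c := by
  conv_rhs => rw [pi_eq_sum_univ' c]
  simp only [map_sum, map_smul, smul_eq_mul, Pi.single]


/-- **Direct sum of systems with multiplication.**
If two systems, on open sets `U ⊆ ℝⁿ` and `Ũ ⊆ ℝⁿ'`, satisfy the multiplication condition,
then the block-diagonal combined system on `U × Ũ`, with function `Z_x · Z̃_y`, also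
satisfies the multiplication condition. -/
theorem direct_sum_multiplication_condition
    (n n' m m' k k' : ℕ) (hm : 1 ≤ m) (hm' : 1 ≤ m')
    (U : Set (Fin n → ℝ)) (hU : IsOpen U)
    (U' : Set (Fin n' → ℝ)) (hU' : IsOpen U')
    (Z : Fin m → (Fin n → ℝ) → ℝ)
    (hZ : ∀ r : Fin m, ∀ x ∈ U, DifferentiableAt ℝ (Z r) x)
    (Z' : Fin m' → (Fin n' → ℝ) → ℝ)
    (hZ' : ∀ r : Fin m', ∀ y ∈ U', DifferentiableAt ℝ (Z' r) y)
    -- the tensors `A_i` (vanishing for `i > k`) and `Ã_i` (vanishing for `i > k'`)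
    (A : ℕ → (Fin n → ℝ) → Matrix (Fin n) (Fin n) ℝ)
    (hA : ∀ i : ℕ, k < i → A i = 0)
    (A' : ℕ → (Fin n' → ℝ) → Matrix (Fin n') (Fin n') ℝ)
    (hA' : ∀ i : ℕ, k' < i → A' i = 0)
    -- the first system satisfies the multiplication condition
    (hcond : ∀ x ∈ U, ∀ a : Fin n,
      (X ^ m + ∑ r : Fin m, Polynomial.C (Z r x) * X ^ (r : ℕ)) ∣
        ∑ i ∈ Finset.range (k + 1), ∑ r : Fin m,
          Polynomial.C (∑ b : Fin n, A i x a b * fderiv ℝ (Z r) x (Pi.single b 1)) *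
            X ^ (i + (r : ℕ)))
    -- the second system satisfies the multiplication condition
    (hcond' : ∀ y ∈ U', ∀ a : Fin n',
      (X ^ m' + ∑ r : Fin m', Polynomial.C (Z' r y) * X ^ (r : ℕ)) ∣
        ∑ i ∈ Finset.range (k' + 1), ∑ r : Fin m',
          Polynomial.C (∑ b : Fin n', A' i y a b * fderiv ℝ (Z' r) y (Pi.single b 1)) *
            X ^ (i + (r : ℕ))) :
    -- then the combined block-diagonal system on `U × Ũ` satisfies it as well
    ∀ p : (Fin n ⊕ Fin n') → ℝ, (p ∘ Sum.inl) ∈ U → (p ∘ Sum.inr) ∈ U' →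
      ∀ a : Fin n ⊕ Fin n',
        ((X ^ m + ∑ r : Fin m, Polynomial.C (Z r (p ∘ Sum.inl)) * X ^ (r : ℕ)) *
            (X ^ m' + ∑ r : Fin m', Polynomial.C (Z' r (p ∘ Sum.inr)) * X ^ (r : ℕ))) ∣
          ∑ i ∈ Finset.range (max k k' + 1), ∑ r ∈ Finset.range (m + m'),
            Polynomial.C (∑ b : Fin n ⊕ Fin n',
                (Matrix.fromBlocks (A i (p ∘ Sum.inl)) 0 0 (A' i (p ∘ Sum.inr))) a b *
                  fderiv ℝ (fun q : (Fin n ⊕ Fin n') → ℝ =>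
                      (((X ^ m + ∑ s : Fin m,
                            Polynomial.C (Z s (q ∘ Sum.inl)) * X ^ (s : ℕ)) *
                          (X ^ m' + ∑ s : Fin m',
                            Polynomial.C (Z' s (q ∘ Sum.inr)) * X ^ (s : ℕ))).coeff r))
                    p (Pi.single b 1)) *
              X ^ (i + r) := by
  intro p hp hp' a
  have hd := fun s => dsm_fderiv_comp Sum.inl (Z s) p (hf := hZ s _ hp)
  have hd' := fun s => dsm_fderiv_comp Sum.inr (Z' s) p (hf := hZ' s _ hp')
  have hsum := dsm_sum m m' (fun s q => Z s (q ∘ Sum.inl)) (fun s q => Z' s (q ∘ Sum.inr)) p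
    (fun s => (hd s 0).1) (fun s => (hd' s 0).1)
  simp only [dsm_lin] at hcond hcond' ⊢
  simp only [hsum, (hd _ _).2, (hd' _ _).2]
  cases a with
  | inl a =>
    have e1 : ∀ i, (Matrix.fromBlocks (A i (p ∘ Sum.inl)) 0 0 (A' i (p ∘ Sum.inr)) (Sum.inl a)) ∘
        Sum.inl = A i (p ∘ Sum.inl) a := fun i => rfl
    have e2 : ∀ i, (Matrix.fromBlocks (A i (p ∘ Sum.inl)) 0 0 (A' i (p ∘ Sum.inr)) (Sum.inl a)) ∘
        Sum.inr = 0 := fun i => rfl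
    simp only [e1, e2, map_zero, zero_mul, Finset.sum_const_zero, mul_zero, add_zero]
    rw [← Finset.sum_mul, dsm_range k (max k k') (le_max_left _ _)]
    · exact mul_dvd_mul_right (hcond _ hp a) _
    · intro i hi
      refine Finset.sum_eq_zero fun s _ => ?_
      have : A i (p ∘ Sum.inl) a = 0 := by rw [hA i hi]; rfl
      rw [this, map_zero, map_zero, zero_mul]
  | inr a =>
    have e1 : ∀ i, (Matrix.fromBlocks (A i (p ∘ Sum.inl)) 0 0 (A' i (p ∘ Sum.inr)) (Sum.inr a)) ∘
        Sum.inl = 0 := fun i => rfl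
    have e2 : ∀ i, (Matrix.fromBlocks (A i (p ∘ Sum.inl)) 0 0 (A' i (p ∘ Sum.inr)) (Sum.inr a)) ∘
        Sum.inr = A' i (p ∘ Sum.inr) a := fun i => rfl
    simp only [e1, e2, map_zero, zero_mul, Finset.sum_const_zero, zero_add]
    rw [← Finset.mul_sum, dsm_range k' (max k k') (le_max_right _ _)]
    · exact mul_dvd_mul_left _ (hcond' _ hp' a)
    · intro i hi
      refine Finset.sum_eq_zero fun s _ => ?_
      have : A' i (p ∘ Sum.inr) a = 0 := by rw [hA' i hi]; rfl
      rw [this, map_zero, map_zero, zero_mul]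
end

section
/- (Vanishing Nijenhuis torsion gives the multiplication condition) Let U ⊆ (Fin n → ℝ) be open and let X : U → Matrix (Fin n) (Fin n) ℝ be differentiable (each entry function X_{ab} : U → ℝ is differentiable on U, where X_{ab} denotes the entry in row a, column b, the row being the upper tensor index). Suppose the Nijenhuis torsion vanishes identically on U: for all x ∈ U and all i, j, k : Fin n, ∑_l ( X_{li}(x)·∂_l X_{kj}(x) − X_{lj}(x)·∂_l X_{ki}(x) − X_{kl}(x)·∂_i X_{lj}(x) + X_{kl}(x)·∂_j X_{li}(x) ) = 0. Then for every μ ∈ ℝ, every x ∈ U and every i : Fin n, ∑_k (X x + μ·1)_{ki} · ∂_k (fun y => det (X y + μ·1)) (x) = det (X x + μ·1) · ∂_i (fun y => Matrix.trace (X y + μ·1)) (x). -/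
lemma fderiv_det_aux (n : ℕ) (A : (Fin n → ℝ) → Matrix (Fin n) (Fin n) ℝ) (x v : Fin n → ℝ)
    (hA : ∀ a b, DifferentiableAt ℝ (fun y => A y a b) x) :
    fderiv ℝ (fun y => (A y).det) x v =
      ∑ j, ∑ k, (A x).adjugate j k * fderiv ℝ (fun y => A y k j) x v := by
  have h1 : HasFDerivAt (fun y => (A y).det)
      (∑ σ : Equiv.Perm (Fin n), ((Equiv.Perm.sign σ : ℤ) : ℝ) •
        ∑ i, (∏ j ∈ Finset.univ.erase i, A x (σ j) j) • fderiv ℝ (fun y => A y (σ i) i) x) x := by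
    simp only [Matrix.det_apply']
    refine HasFDerivAt.fun_sum fun σ _ => ?_
    refine HasFDerivAt.const_mul ?_ _
    exact HasFDerivAt.finset_prod fun i _ => (hA (σ i) i).hasFDerivAt
  have h2 : ∀ j, ∑ k, (A x).adjugate j k * fderiv ℝ (fun y => A y k j) x v =
      ((A x).updateCol j (fun k => fderiv ℝ (fun y => A y k j) x v)).det := by
    intro j
    rw [← Matrix.cramer_apply, Matrix.cramer_eq_adjugate_mulVec]
    rfl
  rw [h1.fderiv]
  simp only [h2, Matrix.det_apply']
  rw [Finset.sum_comm]
  simp only [ContinuousLinearMap.sum_apply, ContinuousLinearMap.smul_apply, smul_eq_mul]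
  refine Finset.sum_congr rfl fun σ _ => ?_
  rw [Finset.mul_sum]
  refine Finset.sum_congr rfl fun i _ => ?_
  rw [← Finset.prod_erase_mul Finset.univ _ (Finset.mem_univ i), Matrix.updateCol_self]
  congr 2
  refine Finset.prod_congr rfl fun j hj => ?_
  rw [Matrix.updateCol_ne (Finset.ne_of_mem_erase hj)]

lemma nijenhuis_alg (n : ℕ) (A : Matrix (Fin n) (Fin n) ℝ) (D : Fin n → Fin n → Fin n → ℝ)
    (i : Fin n)
    (h : ∀ j k, ∑ l, (A l i * D l k j - A l j * D l k i - A k l * D i l j + A k l * D j l i) = 0) :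
    ∑ l, A l i * ∑ j, ∑ k, A.adjugate j k * D l k j = A.det * ∑ k, D i k k := by
  have e0 : ∑ j, ∑ k, A.adjugate j k *
      ∑ l, (A l i * D l k j - A l j * D l k i - A k l * D i l j + A k l * D j l i) = 0 := by
    simp [h]
  have a1 : ∀ l k, ∑ j, A l j * A.adjugate j k = if l = k then A.det else 0 := by
    intro l k
    have := congrFun (congrFun (Matrix.mul_adjugate A) l) k
    simpa [Matrix.mul_apply, Matrix.one_apply] using this
  have a2 : ∀ j l, ∑ k, A.adjugate j k * A k l = if j = l then A.det else 0 := by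
    intro l k
    have := congrFun (congrFun (Matrix.adjugate_mul A) l) k
    simpa [Matrix.mul_apply, Matrix.one_apply] using this
  have t1 : ∑ j, ∑ k, ∑ l, A.adjugate j k * (A l i * D l k j) =
      ∑ l, A l i * ∑ j, ∑ k, A.adjugate j k * D l k j := by
    simp only [Finset.mul_sum]
    rw [Finset.sum_comm (f := fun l j => ∑ k, A l i * (A.adjugate j k * D l k j))]
    refine Finset.sum_congr rfl fun j _ => ?_
    rw [Finset.sum_comm]
    exact Finset.sum_congr rfl fun l _ => Finset.sum_congr rfl fun k _ => by ring
  have t2 : ∑ j, ∑ k, ∑ l, A.adjugate j k * (A l j * D l k i) = A.det * ∑ k, D k k i := by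
    calc _ = ∑ k, ∑ l, (∑ j, A l j * A.adjugate j k) * D l k i := by
          rw [Finset.sum_comm]
          refine Finset.sum_congr rfl fun k _ => ?_
          rw [Finset.sum_comm]
          refine Finset.sum_congr rfl fun l _ => ?_
          rw [Finset.sum_mul]
          exact Finset.sum_congr rfl fun j _ => by ring
      _ = _ := by simp [a1, Finset.mul_sum]
  have t34 : ∀ E : Fin n → Fin n → ℝ,
      ∑ j, ∑ k, ∑ l, A.adjugate j k * (A k l * E l j) = A.det * ∑ k, E k k := by
    intro E
    calc _ = ∑ j, ∑ l, (∑ k, A.adjugate j k * A k l) * E l j := by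
          refine Finset.sum_congr rfl fun k _ => ?_
          rw [Finset.sum_comm]
          refine Finset.sum_congr rfl fun l _ => ?_
          rw [Finset.sum_mul]
          exact Finset.sum_congr rfl fun j _ => by ring
      _ = _ := by simp [a2, Finset.mul_sum]
  have t3 := t34 (fun l j => D i l j)
  have t4 := t34 (fun l j => D j l i)
  simp only [Finset.mul_sum, mul_add, mul_sub, Finset.sum_add_distrib,
    Finset.sum_sub_distrib] at e0
  simp only [← Finset.mul_sum] at e0 t1 t2 t3 t4 ⊢
  linarith

/-- **Vanishing Nijenhuis torsion gives the multiplication condition.**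
If the Nijenhuis torsion of a differentiable matrix-valued map `X` on an open set
`U ⊆ ℝⁿ` vanishes identically, then for all `μ ∈ ℝ`,
`(X + μ I) d(det(X + μ I)) = det(X + μ I) d(tr(X + μ I))` on `U`. -/
theorem nijenhuis_vanishing_mult_condition (n : ℕ) (U : Set (Fin n → ℝ)) (hU : IsOpen U)
    (X : (Fin n → ℝ) → Matrix (Fin n) (Fin n) ℝ)
    (hX : ∀ (a b : Fin n), ∀ x ∈ U, DifferentiableAt ℝ (fun y => X y a b) x)
    (hN : ∀ x ∈ U, ∀ i j k : Fin n,
      (∑ l : Fin n,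
          (X x l i * fderiv ℝ (fun y => X y k j) x (Pi.single l 1) -
           X x l j * fderiv ℝ (fun y => X y k i) x (Pi.single l 1) -
           X x k l * fderiv ℝ (fun y => X y l j) x (Pi.single i 1) +
           X x k l * fderiv ℝ (fun y => X y l i) x (Pi.single j 1))) = 0) :
    ∀ (μ : ℝ), ∀ x ∈ U, ∀ i : Fin n,
      ∑ k : Fin n, (X x + μ • (1 : Matrix (Fin n) (Fin n) ℝ)) k i *
          fderiv ℝ (fun y => (X y + μ • (1 : Matrix (Fin n) (Fin n) ℝ)).det) x (Pi.single k 1) =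
        (X x + μ • (1 : Matrix (Fin n) (Fin n) ℝ)).det *
          fderiv ℝ (fun y => (X y + μ • (1 : Matrix (Fin n) (Fin n) ℝ)).trace) x
            (Pi.single i 1) := by
  intro μ x hx i
  have hd : ∀ a b, (fun y => (X y + μ • (1 : Matrix (Fin n) (Fin n) ℝ)) a b) =
      fun y => X y a b + (μ • (1 : Matrix (Fin n) (Fin n) ℝ)) a b := fun a b => rfl
  have hdiff : ∀ a b, DifferentiableAt ℝ
      (fun y => (X y + μ • (1 : Matrix (Fin n) (Fin n) ℝ)) a b) x := by
    intro a b
    rw [hd]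
    exact (hX a b x hx).add_const _
  have hf : ∀ a b, fderiv ℝ (fun y => (X y + μ • (1 : Matrix (Fin n) (Fin n) ℝ)) a b) x =
      fderiv ℝ (fun y => X y a b) x := by
    intro a b
    rw [hd, fderiv_add_const]
  have htr : fderiv ℝ (fun y => (X y + μ • (1 : Matrix (Fin n) (Fin n) ℝ)).trace) x
      (Pi.single i 1) = ∑ k, fderiv ℝ (fun y => X y k k) x (Pi.single i 1) := by
    have : HasFDerivAt (fun y => (X y + μ • (1 : Matrix (Fin n) (Fin n) ℝ)).trace)
        (∑ k, fderiv ℝ (fun y => X y k k) x) x := by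
      simp only [Matrix.trace, Matrix.diag]
      refine HasFDerivAt.fun_sum fun k _ => ?_
      rw [← hf]
      exact (hdiff k k).hasFDerivAt
    rw [this.fderiv, ContinuousLinearMap.sum_apply]
  rw [htr]
  simp only [fderiv_det_aux n _ x _ hdiff, hf]
  refine nijenhuis_alg n _ (fun l k j => fderiv ℝ (fun y => X y k j) x (Pi.single l 1)) i ?_
  intro j k
  have h := hN x hx i j k
  simp only [Matrix.add_apply, Matrix.smul_apply, Matrix.one_apply, smul_eq_mul, add_mul,
    Finset.sum_add_distrib, Finset.sum_sub_distrib] at h ⊢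
  simp only [mul_ite, mul_one, mul_zero, ite_mul, zero_mul, Finset.sum_ite_eq,
    Finset.sum_ite_eq', Finset.mem_univ, if_true]
  linarith
end

section
/- (Cayley–Hamilton reduction in the generic (2,3,1) case) Let x, y, φ, p, q ∈ ℝ satisfy the two relations x·p² − φ·p + y·p·q − q = 0 and 1 + x·p·q + y·q² − φ·q = 0. Let A := !![x·p, x·q; y·p − 1, y·q] : Matrix (Fin 2) (Fin 2) ℝ. Then A^3 − φ·A^2 + y·A − x·(1 : Matrix (Fin 2) (Fin 2) ℝ) = 0. -/
/-- **Cayley–Hamilton reduction in the generic (2,3,1) case.**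
If `x p² - φ p + y p q - q = 0` and `1 + x p q + y q² - φ q = 0`, then the matrix
`A = !![x p, x q; y p - 1, y q]` satisfies `A³ - φ A² + y A - x I = 0`. -/
theorem cayley_hamilton_231 (x y φ p q : ℝ)
    (h₁ : x * p ^ 2 - φ * p + y * p * q - q = 0)
    (h₂ : 1 + x * p * q + y * q ^ 2 - φ * q = 0) :
    let A : Matrix (Fin 2) (Fin 2) ℝ := !![x * p, x * q; y * p - 1, y * q]
    A ^ 3 - φ • A ^ 2 + y • A - x • (1 : Matrix (Fin 2) (Fin 2) ℝ) = 0 := by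
  intro A
  ext i j
  fin_cases i <;> fin_cases j <;>
    simp [A, pow_succ, Matrix.mul_apply, Fin.sum_univ_two]
  · linear_combination (x * p) * (x * h₁ + y * h₂) - x * h₂
  · linear_combination (x * q) * (x * h₁ + y * h₂)
  · linear_combination (y * p - 1) * (x * h₁ + y * h₂)
  · linear_combination (y * q) * (x * h₁ + y * h₂) - x * h₂
end
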